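/- Let X be a Lie algebra over ℝ and R : X → X a hereditary operator. Suppose y₁ ∈ X satisfies L_{y₁}R = −R². Define yₙ = R^{n−1} y₁ for n ≥ 1. Then [yₙ, yₘ] = (n − m) y_{n+m} for all n, m ≥ 1 (i.e., the yₙ span a Lie algebra of Witt/Virasoro type). -/

import Mathlib

/-- If `R` is hereditary and `L_{y₁}R = −R²`, then the master symmetries
`yₙ = R^{n−1}y₁` (`n = i+1 ≥ 1`) satisfy the Witt/Virasoro-type relations
`[yₙ, yₘ] = (n − m) y_{n+m}`. -/
theorem masterSymmetries_witt {X : Type*} [LieRing X] [LieAlgebra ℝ X]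
    (R : X →ₗ[ℝ] X)
    (hR : ∀ x y : X,
      ⁅R x, R y⁆ - R ⁅R x, y⁆ - R ⁅x, R y⁆ + R (R ⁅x, y⁆) = 0)
    (y₁ : X)
    (hy₁ : ∀ y : X, ⁅y₁, R y⁆ - R ⁅y₁, y⁆ = -(R (R y))) :
    ∀ i j : ℕ,
      ⁅(R ^ i) y₁, (R ^ j) y₁⁆ = ((i : ℝ) - (j : ℝ)) • (R ^ (i + j + 1)) y₁ := by
  have key : ∀ (i : ℕ) (y : X),
      ⁅(R ^ i) y₁, R y⁆ = R ⁅(R ^ i) y₁, y⁆ - (R ^ (i + 2)) y := by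
    intro i
    induction i with
    | zero =>
      intro y
      have h := hy₁ y
      rw [sub_eq_iff_eq_add] at h
      simp only [pow_zero, Module.End.one_apply, zero_add, pow_two, Module.End.mul_apply]
      rw [h]; abel
    | succ k ih =>
      intro y
      have h := hR ((R ^ k) y₁) y
      rw [ih y] at h
      have e : (R ^ (k + 1 + 2)) y = R ((R ^ (k + 2)) y) := by
        rw [show k + 1 + 2 = (k + 2) + 1 by ring, pow_succ', Module.End.mul_apply]
      rw [e, pow_succ', Module.End.mul_apply]
      rw [map_sub] at h
      rw [← sub_eq_zero, ← h]; abel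
  have step : ∀ i : ℕ, ⁅(R ^ i) y₁, y₁⁆ = (i : ℝ) • (R ^ (i + 1)) y₁ →
      ∀ j : ℕ, ⁅(R ^ i) y₁, (R ^ j) y₁⁆
        = ((i : ℝ) - (j : ℝ)) • (R ^ (i + j + 1)) y₁ := by
    intro i h0 j
    induction j with
    | zero => simpa using h0
    | succ j ih =>
      have e1 : R ((R ^ (i + j + 1)) y₁) = (R ^ (i + (j + 1) + 1)) y₁ := by
        rw [← Module.End.mul_apply, ← pow_succ']; rfl
      have e2 : (R ^ (i + 2)) ((R ^ j) y₁) = (R ^ (i + (j + 1) + 1)) y₁ := by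
        rw [← Module.End.mul_apply, ← pow_add]
        congr 2; ring
      rw [pow_succ' R j, Module.End.mul_apply, key, ih, map_smul, e1, e2]
      push_cast
      module
  have h0 := step 0 (by simp)
  intro i j
  refine step i ?_ j
  have h := h0 i
  simp only [pow_zero, Module.End.one_apply, zero_add] at h
  rw [← lie_skew, h]
  push_cast
  module
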